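/- arXiv:math/0512570 — 3 statements merged into one kernel-verified Lean document; each statement's English description precedes it below -/
import Mathlib

section
/- For every integer r ≥ 1, the following identity holds in the formal power series ring ℚ[[x]]: (1 + Σ_{n≥1} (n+1)^{n−1} x^n/n!) · (Σ_{n≥0} (n+r−1)^n x^n/n!) = Σ_{n≥0} (n+r)^n x^n/n!, with the convention 0^0 = 1. In particular, the exponential generating function of parking functions, Σ_{n≥0} |PF_n| x^n/n!, equals the quotient (Σ_{n≥0} (n+r)^n x^n/n!)/(Σ_{n≥0} (n+r−1)^n x^n/n!) for every r ≥ 1, independently of r. -/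
open Finset PowerSeries

open scoped Classical in
/-- The set of parking functions of length `n`, encoded as functions
`f : Fin n → Fin n`, where `f j` represents the letter `(f j : ℕ) + 1 ∈ {1,…,n}`.
The defining condition is that the nondecreasing rearrangement
`f ∘ Tuple.sort f` satisfies `a↑ᵢ ≤ i` (with 1-based indexing). -/
noncomputable def PFset (n : ℕ) : Finset (Fin n → Fin n) :=
  Finset.univ.filter fun f =>
    ∀ i : Fin n, ((f ∘ Tuple.sort f) i : ℕ) + 1 ≤ (i : ℕ) + 1

/-- The case `x = 1` of Abel's binomial theorem, as an identity of polynomials. -/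
theorem Polynomial.sum_abel_one (n : ℕ) :
    ∑ k ∈ range (n + 1), Polynomial.C ((n.choose k : ℚ) * (k + 1) ^ (k - 1)) *
        (Polynomial.X + Polynomial.C ((n - k : ℕ) : ℚ)) ^ (n - k) =
      (Polynomial.X + Polynomial.C ((n : ℚ) + 1)) ^ n := by
  induction n with
  | zero => simp
  | succ n ih =>
    set S : Polynomial ℚ := ∑ k ∈ range (n + 1 + 1),
      Polynomial.C (((n + 1).choose k : ℚ) * (k + 1) ^ (k - 1)) *
        (Polynomial.X + Polynomial.C ((n + 1 - k : ℕ) : ℚ)) ^ (n + 1 - k) with hS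
    set T : Polynomial ℚ := (Polynomial.X + Polynomial.C (((n + 1 : ℕ) : ℚ) + 1)) ^ (n + 1) with hT
    have hder : Polynomial.derivative (S - T) = 0 := by
      have ih' := congrArg (fun p => Polynomial.C ((n : ℚ) + 1) *
        Polynomial.compRingHom (Polynomial.X + 1) p) ih
      simp only [map_sum, Polynomial.coe_compRingHom_apply, Polynomial.mul_comp, Polynomial.pow_comp,
        Polynomial.add_comp, Polynomial.X_comp, Polynomial.C_comp, Finset.mul_sum] at ih'
      rw [Polynomial.derivative_sub, sub_eq_zero, hS, hT, sum_range_succ, Polynomial.derivative_add]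
      simp only [Polynomial.derivative_sum, Polynomial.derivative_C_mul,
        Polynomial.derivative_X_add_C_pow]
      convert ih' using 1
      · simp only [Nat.sub_self, Nat.cast_zero, map_zero, zero_mul, mul_zero, add_zero]
        refine sum_congr rfl fun k hk => ?_
        have hk : k ≤ n := by simpa [Nat.lt_succ_iff] using hk
        obtain ⟨m, rfl⟩ := Nat.exists_eq_add_of_le hk
        have h := Nat.choose_mul_succ_eq (k + m) k
        rw [show k + m + 1 - k = m + 1 by omega] at h ⊢
        rw [show k + m - k = m by omega]
        have h' : ((k + m).choose k : ℚ) * ((k + m : ℕ) + 1) =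
            ((k + m + 1).choose k : ℚ) * (m + 1) := by exact_mod_cast h
        have e : (Polynomial.X + Polynomial.C ((m + 1 : ℕ) : ℚ)) =
            Polynomial.X + 1 + Polynomial.C (m : ℚ) := by
          simp only [Nat.cast_add, Nat.cast_one, map_add, map_one]; ring
        rw [e, Nat.add_sub_cancel, ← mul_assoc, ← mul_assoc, ← map_mul, ← map_mul]
        congr 2
        push_cast at h' ⊢
        linear_combination (-((k : ℚ) + 1) ^ (k - 1)) * h'
      · rw [Nat.add_sub_cancel]
        simp only [Nat.cast_add, Nat.cast_one, map_add, map_one]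
        ring
    have hev : Polynomial.eval (-((n : ℚ) + 2)) (S - T) = 0 := by
      have h := congrFun (fwdDiff_iter_pow_eq_zero_of_lt (R := ℚ) (Nat.lt_succ_self n)) 1
      rw [fwdDiff_iter_eq_sum_shift] at h
      rw [Polynomial.eval_sub, hS, hT]
      simp only [Polynomial.eval_finsetSum, Polynomial.eval_mul, Polynomial.eval_pow,
        Polynomial.eval_add, Polynomial.eval_X, Polynomial.eval_C]
      rw [show (-((n : ℚ) + 2) + (((n + 1 : ℕ) : ℚ) + 1)) = 0 by push_cast; ring,
        zero_pow (Nat.succ_ne_zero n), sub_zero]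
      refine Eq.trans (sum_congr rfl fun k hk => ?_) h
      have hk : k ≤ n + 1 := by simpa [Nat.lt_succ_iff] using hk
      rw [Nat.cast_sub hk, show (-((n : ℚ) + 2) + (((n + 1 : ℕ) : ℚ) - k)) = (-1) * (k + 1) by
        push_cast; ring, mul_pow]
      have e : ((k : ℚ) + 1) ^ (k - 1) * (k + 1) ^ (n + 1 - k) = (k + 1) ^ n := by
        rcases k with _ | k
        · simp
        · rw [← pow_add]; congr 1; omega
      simp only [nsmul_eq_mul, zsmul_eq_mul, mul_one]
      push_cast
      rw [add_comm (1 : ℚ), ← e]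
      ring
    rw [Polynomial.eq_C_of_derivative_eq_zero hder, Polynomial.eval_C] at hev
    have := Polynomial.eq_C_of_derivative_eq_zero hder
    rwa [hev, map_zero, sub_eq_zero] at this

/-- Parking functions indexed by an arbitrary finite type, with letters starting at `0`. -/
def parkingFunctions (α : Type*) [Fintype α] [DecidableEq α] : Finset (α → ℕ) :=
  {f ∈ Fintype.piFinset fun _ => range (Fintype.card α) |
    ∀ i < Fintype.card α, i < #{a | f a ≤ i}}

theorem mem_PFset_iff {n : ℕ} (f : Fin n → Fin n) :
    f ∈ PFset n ↔ ∀ i < n, i < #{j | (f j : ℕ) ≤ i} := by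
  have key (i : Fin n) : ((f ∘ Tuple.sort f) i : ℕ) + 1 ≤ (i : ℕ) + 1 ↔
      (i : ℕ) < #{j | (f j : ℕ) ≤ i} := by
    rw [Nat.succ_le_succ_iff, ← Fin.le_def,
      ← Tuple.lt_card_le_iff_apply_le_of_monotone (Tuple.monotone_sort f)]
    have : #{j : Fin n | (f ∘ Tuple.sort f) j ≤ i} = #{j : Fin n | (f j : ℕ) ≤ i} :=
      card_equiv (Tuple.sort f) fun j => by
        simp only [mem_filter, mem_univ, true_and, Function.comp_apply, Fin.le_def]
    rw [this]
  simp only [PFset, mem_filter, mem_univ, true_and, key]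
  exact ⟨fun h i hi => h ⟨i, hi⟩, fun h i => h i i.2⟩

theorem card_parkingFunctions (α : Type*) [Fintype α] [DecidableEq α] :
    #(parkingFunctions α) = #(PFset (Fintype.card α)) := by
  symm
  let e := Fintype.equivFin α
  have hcard (f : Fin (Fintype.card α) → ℕ) (i : ℕ) : #{a | f (e a) ≤ i} = #{j | f j ≤ i} :=
    card_equiv e (by simp)
  refine card_bij (fun f _ a => (f (e a) : ℕ)) (fun f hf => ?_) (fun f _ g _ h => ?_)
    fun g hg => ?_
  · rw [mem_PFset_iff] at hf
    simp only [parkingFunctions, mem_filter, Fintype.mem_piFinset, mem_range, Fin.is_lt,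
      implies_true, true_and]
    intro i hi
    rw [hcard (fun j => (f j : ℕ))]
    exact hf i hi
  · ext j
    simpa using congrFun h (e.symm j)
  · simp only [parkingFunctions, mem_filter, Fintype.mem_piFinset, mem_range] at hg
    refine ⟨fun j => ⟨g (e.symm j), hg.1 _⟩, ?_, by simp⟩
    rw [mem_PFset_iff]
    intro i hi
    rw [← hcard (fun j => g (e.symm j))]
    simpa using hg.2 i hi

section Decomposition

variable {α : Type*} [Fintype α]

theorem exists_card_le (f : α → ℕ) : ∃ i, #{a | f a ≤ i} ≤ i :=
  ⟨Fintype.card α, card_le_univ _⟩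

/-- The first spot left empty when cars with preferences `f` park on a half-infinite street. -/
def firstGap (f : α → ℕ) : ℕ := Nat.find (exists_card_le f)

variable [DecidableEq α]

theorem filter_lt_firstGap_eq_iff (f : α → ℕ) (A : Finset α) :
    ({a | f a < firstGap f} : Finset α) = A ↔
      (∀ a ∈ A, f a < #A) ∧ (∀ a ∉ A, #A < f a) ∧ ∀ i < #A, i < #{a ∈ A | f a ≤ i} := by
  constructor
  · rintro rfl
    have hle : #{a | f a ≤ firstGap f} ≤ firstGap f := Nat.find_spec (exists_card_le f)
    have hlt (i) (hi : i < firstGap f) : i < #{a | f a ≤ i} :=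
      not_le.1 (Nat.find_min (exists_card_le f) hi)
    have hsub : ({a | f a < firstGap f} : Finset α) ⊆ ({a | f a ≤ firstGap f} : Finset α) :=
      monotone_filter_right _ fun a _ h => le_of_lt h
    have hge : firstGap f ≤ #{a | f a < firstGap f} := by
      rcases h : firstGap f with _ | k
      · simp
      · simpa [Nat.lt_succ_iff] using hlt k (by omega)
    have hcard : #{a | f a < firstGap f} = firstGap f :=
      le_antisymm ((card_le_card hsub).trans hle) hge
    have heq := eq_of_subset_of_card_le hsub (hle.trans hge)
    rw [hcard]
    refine ⟨by simp, fun a ha => ?_, fun i hi => ?_⟩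
    · rw [heq] at ha
      simpa using ha
    · convert hlt i hi using 2
      ext a
      simp only [mem_filter, mem_univ, true_and]
      omega
  · rintro ⟨h1, h2, h3⟩
    have hgap : firstGap f = #A := by
      rw [firstGap, Nat.find_eq_iff]
      refine ⟨card_le_card fun a ha => ?_, fun i hi => ?_⟩
      · by_contra h
        exact absurd (h2 a h) (by simpa using ha)
      · exact not_le.2 ((h3 i hi).trans_le (card_le_card (filter_subset_filter _ (subset_univ _))))
    ext a
    rw [hgap]
    by_cases ha : a ∈ A
    · simp [ha, h1 a ha]
    · simp [ha, (h2 a ha).le]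

theorem card_filter_lt_firstGap_eq (m : ℕ) (hm : Fintype.card α ≤ m) (A : Finset α) :
    #{f ∈ Fintype.piFinset fun _ : α => range m | ({a | f a < firstGap f} : Finset α) = A} =
      #(PFset #A) * (m - 1 - #A) ^ (Fintype.card α - #A) := by
  have hA : #A ≤ m := (card_le_univ A).trans hm
  have h1 : #(PFset #A) = #(parkingFunctions {a // a ∈ A}) := by
    rw [card_parkingFunctions, Fintype.card_coe]
  have h2 : (m - 1 - #A) ^ (Fintype.card α - #A) =
      #(Fintype.piFinset fun _ : {a // a ∉ A} => Ioo #A m) := by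
    rw [Fintype.card_piFinset, prod_const, card_univ, Nat.card_Ioo, Fintype.card_subtype_compl, Fintype.card_coe]
    congr 1
    omega
  rw [h1, h2, ← card_product]
  refine card_equiv (Equiv.piEquivPiSubtypeProd (fun a => a ∈ A) fun _ => ℕ) fun f => ?_
  have hcard (i : ℕ) : #{a : {a // a ∈ A} | f a ≤ i} = #{a ∈ A | f a ≤ i} := by
    rw [← card_map (Function.Embedding.subtype _)]
    congr 1
    ext a
    simp [and_comm]
  simp only [mem_filter, Fintype.mem_piFinset, mem_range, filter_lt_firstGap_eq_iff, mem_product,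
    parkingFunctions, Equiv.piEquivPiSubtypeProd_apply, Fintype.card_coe, hcard, mem_Ioo,
    Subtype.forall]
  constructor
  · rintro ⟨h, h1, h2, h3⟩
    exact ⟨⟨h1, h3⟩, fun a ha => ⟨h2 a ha, h a⟩⟩
  · rintro ⟨⟨h1, h3⟩, h2⟩
    refine ⟨fun a => ?_, h1, fun a ha => (h2 a ha).1, h3⟩
    by_cases ha : a ∈ A
    · exact (h1 a ha).trans_le hA
    · exact (h2 a ha).2

end Decomposition

theorem sum_choose_mul_card_PFset (n m : ℕ) (hm : n ≤ m) :
    ∑ k ∈ range (n + 1), n.choose k * (#(PFset k) * (m - 1 - k) ^ (n - k)) = m ^ n := by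
  have h := card_eq_sum_card_fiberwise (s := Fintype.piFinset fun _ : Fin n => range m)
    (t := univ.powerset) (f := fun f => ({a | f a < firstGap f} : Finset (Fin n)))
    (fun f _ => by simp)
  simp only [card_filter_lt_firstGap_eq m ((Fintype.card_fin n).trans_le hm)] at h
  rw [sum_powerset_apply_card (fun k => #(PFset k) * (m - 1 - k) ^ (Fintype.card (Fin n) - k))] at h
  simpa using h.symm

theorem sum_choose_mul_abel_one (n s : ℕ) :
    ∑ k ∈ range (n + 1), n.choose k * ((k + 1) ^ (k - 1) * (n - k + s) ^ (n - k)) =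
      (n + s + 1) ^ n := by
  have h := congrArg (Polynomial.eval (s : ℚ)) (Polynomial.sum_abel_one n)
  simp only [Polynomial.eval_finsetSum, Polynomial.eval_mul, Polynomial.eval_pow,
    Polynomial.eval_add, Polynomial.eval_X, Polynomial.eval_C] at h
  rw [← Nat.cast_inj (R := ℚ)]
  push_cast
  convert h using 1
  · exact sum_congr rfl fun k _ => by ring
  · ring

/-- The binomial convolution identity for the product of exponential generating functions. -/
theorem PowerSeries.mk_div_factorial_mul {a b c : ℕ → ℕ}
    (h : ∀ n, ∑ k ∈ range (n + 1), n.choose k * (a k * b (n - k)) = c n) :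
    (PowerSeries.mk fun n => (a n : ℚ) / n.factorial) *
        (PowerSeries.mk fun n => (b n : ℚ) / n.factorial) =
      PowerSeries.mk fun n => (c n : ℚ) / n.factorial := by
  ext n
  rw [PowerSeries.coeff_mul, Nat.sum_antidiagonal_eq_sum_range_succ_mk, PowerSeries.coeff_mk,
    ← h n, Nat.cast_sum, sum_div]
  refine sum_congr rfl fun k hk => ?_
  have hk : k ≤ n := by simpa [Nat.lt_succ_iff] using hk
  have h0 := Nat.factorial_ne_zero
  simp only [PowerSeries.coeff_mk]
  push_cast
  rw [Nat.cast_choose ℚ hk]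
  have := h0 n
  have := h0 k
  have := h0 (n - k)
  field_simp

theorem stmt3 (r : ℕ) (hr : 1 ≤ r) :
    (PowerSeries.mk fun n => (((n + 1) ^ (n - 1) : ℕ) : ℚ) / n.factorial) *
        (PowerSeries.mk fun n => (((n + r - 1) ^ n : ℕ) : ℚ) / n.factorial) =
      (PowerSeries.mk fun n => (((n + r) ^ n : ℕ) : ℚ) / n.factorial) ∧
    (PowerSeries.mk fun n => ((PFset n).card : ℚ) / n.factorial) *
        (PowerSeries.mk fun n => (((n + r - 1) ^ n : ℕ) : ℚ) / n.factorial) =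
      (PowerSeries.mk fun n => (((n + r) ^ n : ℕ) : ℚ) / n.factorial) := by
  refine ⟨PowerSeries.mk_div_factorial_mul fun n => ?_, PowerSeries.mk_div_factorial_mul fun n => ?_⟩
  · obtain ⟨s, rfl⟩ := Nat.exists_eq_add_of_le' hr
    exact sum_choose_mul_abel_one n s
  · rw [← sum_choose_mul_card_PFset n (n + r) (Nat.le_add_right n r)]
    refine sum_congr rfl fun k hk => ?_
    rw [mem_range] at hk
    rw [show n - k + r - 1 = n + r - 1 - k by omega]
end

section
/- For all integers n ≥ 1 and 1 ≤ k ≤ n, the number of nondecreasing parking functions b of length n with m(b) = k is (k/n) · C(2n−k−1, n−1), where m(b) = #{j ∈ {0,1,…,n−1} : b_{j+1} = j+1} is the number of factors in the maximal factorization of b into connected nondecreasing parking functions by shifted concatenation. -/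
open Finset

open scoped Classical in
/-- The set of nondecreasing parking functions of length `n`, encoded as
monotone functions `f : Fin n → Fin n`, where `f j` represents the letter
`(f j : ℕ) + 1 ∈ {1,…,n}`; the parking condition `bᵢ ≤ i` (1-based) reads
`(f i : ℕ) ≤ i`. -/
noncomputable def NDPFset (n : ℕ) : Finset (Fin n → Fin n) :=
  Finset.univ.filter fun f =>
    Monotone f ∧ ∀ i : Fin n, (f i : ℕ) + 1 ≤ (i : ℕ) + 1

open scoped Classical in
/-- `m(b) = #{j ∈ {0,…,n-1} : b_{j+1} = j + 1}`, the number of connected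
factors of `b`; with our encoding (letter = value + 1) the condition
`b_{j+1} = j + 1` reads `f j = j`. -/
noncomputable def numFactors {n : ℕ} (f : Fin n → Fin n) : ℕ :=
  (Finset.univ.filter fun j : Fin n => (f j : ℕ) = (j : ℕ)).card

open scoped Classical in
/-- Monotone words `g` of length `n` with `g i ≤ i`, letters at most `v`, and exactly `k` fixed
points. -/
noncomputable def boundedWords (n v k : ℕ) : Finset (Fin n → ℕ) :=
  (Fintype.piFinset fun i : Fin n => range ((i : ℕ) + 1)).filter fun g =>
    Monotone g ∧ (∀ i, g i ≤ v) ∧ (univ.filter fun j : Fin n => g j = (j : ℕ)).card = k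

lemma mem_boundedWords {n v k : ℕ} {g : Fin n → ℕ} :
    g ∈ boundedWords n v k ↔ (∀ i, g i ≤ (i : ℕ)) ∧ Monotone g ∧ (∀ i, g i ≤ v) ∧
      (univ.filter fun j : Fin n => g j = (j : ℕ)).card = k := by
  simp [boundedWords]

lemma card_fixed_snoc {n v : ℕ} (g : Fin n → ℕ) :
    (univ.filter fun j : Fin (n + 1) => (Fin.snoc g v : Fin (n + 1) → ℕ) j = (j : ℕ)).card =
      (univ.filter fun j : Fin n => g j = (j : ℕ)).card + if v = n then 1 else 0 := by
  simp only [card_filter, Fin.sum_univ_castSucc, Fin.snoc_castSucc, Fin.snoc_last,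
    Fin.val_castSucc, Fin.val_last]

lemma monotone_snoc {n v : ℕ} {g : Fin n → ℕ} (hg : Monotone g) (hv : ∀ i, g i ≤ v) :
    Monotone (Fin.snoc g v : Fin (n + 1) → ℕ) := by
  intro i j
  refine Fin.lastCases ?_ (fun j => ?_) j <;> refine Fin.lastCases ?_ (fun i => ?_) i
  · simp
  · simpa using fun _ => hv i
  · intro h
    exact absurd h (not_le.2 (Fin.castSucc_lt_last j))
  · intro h
    simpa using hg (by simpa using h)

lemma card_boundedWords_last_eq {n v : ℕ} (hv : v ≤ n) (k : ℕ) :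
    ((boundedWords (n + 1) v (k + if v = n then 1 else 0)).filter
      fun g => g (Fin.last n) = v).card = (boundedWords n v k).card := by
  symm
  refine card_bij (fun g _ => (Fin.snoc g v : Fin (n + 1) → ℕ)) ?_ ?_ ?_
  · intro g hg
    obtain ⟨h1, h2, h3, h4⟩ := mem_boundedWords.1 hg
    rw [mem_filter, mem_boundedWords]
    refine ⟨⟨?_, monotone_snoc h2 h3, ?_, ?_⟩, by simp⟩
    · intro i
      refine Fin.lastCases ?_ (fun i => ?_) i
      · simpa using hv
      · simpa using h1 i
    · intro i
      refine Fin.lastCases ?_ (fun i => ?_) i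
      · simp
      · simpa using h3 i
    · rw [card_fixed_snoc, h4]
  · intro g _ g' _ h
    exact (Fin.snoc_injective2 h).1
  · intro g hg
    obtain ⟨hg, hl⟩ := mem_filter.1 hg
    obtain ⟨h1, h2, h3, h4⟩ := mem_boundedWords.1 hg
    have hs : (Fin.snoc (Fin.init g) v : Fin (n + 1) → ℕ) = g := by
      rw [← hl]
      exact Fin.snoc_init_self g
    refine ⟨Fin.init g, mem_boundedWords.2 ⟨fun i => ?_, fun i j hij => ?_, fun i => ?_, ?_⟩, hs⟩
    · exact h1 i.castSucc
    · exact h2 (Fin.castSucc_le_castSucc_iff.2 hij)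
    · exact h3 i.castSucc
    · rw [← hs, card_fixed_snoc] at h4
      omega

lemma card_boundedWords_zero_bound (n k : ℕ) :
    (boundedWords (n + 1) 0 (k + if 0 = n then 1 else 0)).card = (boundedWords n 0 k).card := by
  rw [← card_boundedWords_last_eq (Nat.zero_le n), filter_true_of_mem]
  intro g hg
  exact Nat.le_zero.1 ((mem_boundedWords.1 hg).2.2.1 _)

lemma card_boundedWords_succ_bound {n v : ℕ} (hv : v + 1 ≤ n) (k : ℕ) :
    (boundedWords (n + 1) (v + 1) (k + if v + 1 = n then 1 else 0)).card =
      (boundedWords n (v + 1) k).card +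
        (boundedWords (n + 1) v (k + if v + 1 = n then 1 else 0)).card := by
  rw [← card_boundedWords_last_eq hv,
    ← card_filter_add_card_filter_not (fun g : Fin (n + 1) → ℕ => g (Fin.last n) = v + 1)]
  congr 2
  ext g
  simp only [mem_filter, mem_boundedWords]
  constructor
  · rintro ⟨⟨h1, h2, h3, h4⟩, h5⟩
    have h6 := h3 (Fin.last n)
    exact ⟨h1, h2, fun i => (h2 (Fin.le_last i)).trans (by omega), h4⟩
  · rintro ⟨h1, h2, h3, h4⟩
    have h6 := h3 (Fin.last n)
    exact ⟨⟨h1, h2, fun i => (h3 i).trans (by omega), h4⟩, by omega⟩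

lemma boundedWords_succ_self (n k : ℕ) :
    boundedWords (n + 1) (n + 1) k = boundedWords (n + 1) n k := by
  ext g
  simp only [mem_boundedWords]
  constructor
  · rintro ⟨h1, h2, -, h4⟩
    exact ⟨h1, h2, fun i => (h1 i).trans (by omega), h4⟩
  · rintro ⟨h1, h2, h3, h4⟩
    exact ⟨h1, h2, fun i => (h3 i).trans (by omega), h4⟩

lemma boundedWords_eq_empty_of_lt {n k : ℕ} (h : n < k) (v : ℕ) : boundedWords n v k = ∅ := by
  refine eq_empty_of_forall_notMem fun g hg => ?_
  have h4 := (mem_boundedWords.1 hg).2.2.2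
  have := card_filter_le (univ : Finset (Fin n)) fun j => g j = (j : ℕ)
  simp only [card_univ, Fintype.card_fin] at this
  omega

lemma boundedWords_fixed_zero (n v : ℕ) : boundedWords (n + 1) v 0 = ∅ := by
  refine eq_empty_of_forall_notMem fun g hg => ?_
  obtain ⟨h1, -, -, h4⟩ := mem_boundedWords.1 hg
  rw [card_eq_zero, filter_eq_empty_iff] at h4
  exact h4 (mem_univ 0) (Nat.le_zero.1 (h1 0))

lemma card_boundedWords_zero : (boundedWords 0 0 0).card = 1 := by
  rw [card_eq_one]
  refine ⟨Fin.elim0, ?_⟩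
  ext g
  simp [mem_boundedWords, Subsingleton.elim g Fin.elim0, Subsingleton.monotone]

/-- The ballot-type formula
`#(boundedWords (n + 1) v (k + 1)) = C(n + v - k, n) - C(n + v - k, n + 1)`. -/
lemma card_boundedWords_add_choose (n : ℕ) : ∀ v k : ℕ, v ≤ n → k ≤ n →
    (boundedWords (n + 1) v (k + 1)).card + (n + v - k).choose (n + 1) =
      (n + v - k).choose n := by
  induction n with
  | zero =>
    intro v k hv hk
    obtain rfl := Nat.le_zero.1 hv
    obtain rfl := Nat.le_zero.1 hk
    have := card_boundedWords_zero_bound 0 0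
    simp only [if_true] at this
    simp [this, card_boundedWords_zero]
  | succ n ih =>
    intro v
    induction v with
    | zero =>
      intro k _ hk
      have h := card_boundedWords_zero_bound (n + 1) (k + 1)
      rw [if_neg (by omega)] at h
      simp only [add_zero] at h ⊢
      rw [h]
      rcases hk.eq_or_lt with rfl | hk
      · simp [boundedWords_eq_empty_of_lt]
      · have := ih 0 k (by omega) (by omega)
        rw [Nat.choose_eq_zero_of_lt (show n + 1 - k < n + 1 + 1 by omega)]
        rw [Nat.choose_eq_zero_of_lt (show n + 0 - k < n + 1 by omega)] at this
        rcases k with _ | k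
        · simpa using this
        · rw [Nat.choose_eq_zero_of_lt (by omega)] at this ⊢
          exact this
    | succ v ihv =>
      intro k hv hk
      have hlow := ihv k (by omega) hk
      have h := card_boundedWords_succ_bound hv
      rcases hv.eq_or_lt with hvn | hvn
      · obtain rfl : v = n := by omega
        replace h := h k
        rw [if_pos rfl, boundedWords_succ_self] at h
        rw [h]
        have e : v + 1 + (v + 1) - k = (v + 1 + v - k) + 1 := by omega
        rw [e, Nat.choose_succ_succ', Nat.choose_succ_succ']
        rcases k with _ | k
        · rw [boundedWords_fixed_zero, card_empty]
          have := Nat.choose_symm_half v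
          have e2 : v + 1 + v - 0 = 2 * v + 1 := by omega
          rw [e2] at hlow ⊢
          omega
        · have := ih v k le_rfl (by omega)
          have e2 : v + 1 + v - (k + 1) = v + v - k := by omega
          rw [e2] at hlow ⊢
          omega
      · replace h := h (k + 1)
        rw [if_neg (by omega)] at h
        simp only [add_zero] at h
        rw [h]
        rcases hk.eq_or_lt with rfl | hk
        · rw [boundedWords_eq_empty_of_lt (by omega), card_empty]
          simp only [Nat.add_sub_cancel_left] at hlow ⊢
          rw [Nat.choose_eq_zero_of_lt (by omega)] at hlow ⊢
          rw [Nat.choose_eq_zero_of_lt (by omega)] at hlow ⊢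
          omega
        · have := ih (v + 1) k (by omega) (by omega)
          have e : n + 1 + (v + 1) - k = (n + 1 + v - k) + 1 := by omega
          have e2 : n + (v + 1) - k = n + 1 + v - k := by omega
          rw [e2] at this
          rw [e, Nat.choose_succ_succ', Nat.choose_succ_succ']
          omega

lemma mem_NDPFset {n : ℕ} {f : Fin n → Fin n} :
    f ∈ NDPFset n ↔ Monotone f ∧ ∀ i, (f i : ℕ) ≤ (i : ℕ) := by
  simp [NDPFset]

lemma card_filter_numFactors_eq (n k : ℕ) :
    ((NDPFset (n + 1)).filter fun f => numFactors f = k).card =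
      (boundedWords (n + 1) n k).card := by
  refine card_bij (fun f _ i => (f i : ℕ)) ?_ ?_ ?_
  · intro f hf
    rw [mem_filter, mem_NDPFset] at hf
    obtain ⟨⟨h1, h2⟩, h3⟩ := hf
    refine mem_boundedWords.2 ⟨h2, fun i j hij => h1 hij,
      fun i => Nat.le_of_lt_succ (f i).2, ?_⟩
    unfold numFactors at h3
    convert h3
  · intro f _ g _ h
    funext i
    exact Fin.ext (congrFun h i)
  · intro g hg
    obtain ⟨h1, h2, h3, h4⟩ := mem_boundedWords.1 hg
    refine ⟨fun i => ⟨g i, Nat.lt_succ_of_le (h3 i)⟩, ?_, rfl⟩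
    rw [mem_filter, mem_NDPFset]
    refine ⟨⟨fun i j hij => h2 hij, h1⟩, ?_⟩
    unfold numFactors
    convert h4

theorem stmt12 (n k : ℕ) (hn : 1 ≤ n) (hk1 : 1 ≤ k) (hkn : k ≤ n) :
    (((NDPFset n).filter fun f => numFactors f = k).card : ℚ) =
      (k : ℚ) / n * ((2 * n - k - 1).choose (n - 1)) := by
  obtain ⟨n, rfl⟩ : ∃ m, n = m + 1 := ⟨n - 1, by omega⟩
  obtain ⟨k, rfl⟩ : ∃ l, k = l + 1 := ⟨k - 1, by omega⟩
  have h := card_boundedWords_add_choose n n k le_rfl (by omega)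
  have hc := Nat.choose_succ_right_eq (n + n - k) n
  have e1 : 2 * (n + 1) - (k + 1) - 1 = n + n - k := by omega
  have e2 : n + n - k - n = n - k := by omega
  rw [e2] at hc
  have hkn' : k ≤ n := by omega
  rw [card_filter_numFactors_eq, e1, Nat.add_sub_cancel]
  have h' := congrArg (Nat.cast (R := ℚ)) h
  have hc' := congrArg (Nat.cast (R := ℚ)) hc
  push_cast [Nat.cast_sub hkn'] at h' hc' ⊢
  have hn0 : (n : ℚ) + 1 ≠ 0 := by positivity
  field_simp
  linear_combination ((n : ℚ) + 1) * h' - hc'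
end

section
/- (Pitman–Stanley) For all integers n ≥ 1, k ≥ 1, l ≥ 1, the number of (k,l)-parking functions of length n is |PF_n^{(k,l)}| = l(l+kn)^{n−1}. -/
open Finset

open scoped Classical in
/-- The set of `(k,l)`-parking functions of length `n`: words over the
positive integers whose nondecreasing rearrangement satisfies
`a↑ᵢ ≤ l + (i-1)k` (1-based `i`). Since all letters are then at most
`l + (n-1)k`, they are encoded as functions `f : Fin n → Fin (l + (n-1)*k)`,
`f j` representing the letter `(f j : ℕ) + 1`; the condition reads
`((f ∘ Tuple.sort f) i : ℕ) < l + i * k` (now with 0-based `i`). -/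
noncomputable def klPFset (n k l : ℕ) : Finset (Fin n → Fin (l + (n - 1) * k)) :=
  Finset.univ.filter fun f =>
    ∀ i : Fin n, ((f ∘ Tuple.sort f) i : ℕ) < l + (i : ℕ) * k

/-- The order-free form of the parking condition: for every `t < |α|`, more than `t` of the values
of `f` are smaller than `l + t * k`. -/
def IsParking {α : Type*} [Fintype α] (k l : ℕ) (f : α → ℕ) : Prop :=
  ∀ t < Fintype.card α, t < #{j | f j < l + t * k}

namespace IsParking

variable {α : Type*} [Fintype α] {k l : ℕ} {f : α → ℕ}

theorem apply_lt (hf : IsParking k l f) (j : α) : f j < l + (Fintype.card α - 1) * k := by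
  have hpos : 0 < Fintype.card α := Fintype.card_pos_iff.mpr ⟨j⟩
  have h := hf (Fintype.card α - 1) (by omega)
  have huniv : ({j | f j < l + (Fintype.card α - 1) * k} : Finset α) = univ := by
    rw [← Finset.card_eq_iff_eq_univ]
    exact le_antisymm (Finset.card_le_univ _) (by omega)
  simpa using Finset.eq_univ_iff_forall.mp huniv j

instance : Finite {f : α → ℕ // IsParking k l f} :=
  Finite.of_injective
    (fun f j => (⟨f.1 j, f.2.apply_lt j⟩ : Fin (l + (Fintype.card α - 1) * k)))
    fun _ _ h => Subtype.ext <| funext fun j => congrArg Fin.val (congrFun h j)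

theorem iff_of_lt_iff_mem [DecidableEq α] (A : Finset α) (hA : ∀ j, f j < l ↔ j ∈ A) :
    IsParking k l f ↔ IsParking k (k * #A) (fun j : {j // j ∉ A} => f j - l) := by
  have hcard : Fintype.card {j // j ∉ A} = Fintype.card α - #A := by
    simp [Fintype.card_subtype_compl]
  have hle : #A ≤ Fintype.card α := Finset.card_le_univ A
  have hcount (t : ℕ) : #{j | f j < l + (#A + t) * k} =
      #A + #{j : {j // j ∉ A} | f j - l < k * #A + t * k} := by
    rw [← Finset.card_filter_add_card_filter_not (s := {j | f j < l + (#A + t) * k}) (· ∈ A)]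
    congr 1
    · congr 1
      ext j
      simp only [mem_filter, mem_univ, true_and, and_iff_right_iff_imp]
      intro hj
      have := (hA j).2 hj
      omega
    · rw [← Finset.card_map (Function.Embedding.subtype _)]
      congr 1
      ext j
      simp only [mem_filter, mem_univ, true_and, mem_map, Function.Embedding.subtype_apply,
        Subtype.exists, exists_and_left, exists_prop, exists_eq_right_right]
      refine and_congr_left fun hj => ?_
      have := mt (hA j).1 hj
      rw [add_mul, mul_comm k]
      omega
  constructor
  · intro h t ht
    have := h (#A + t) (by omega)
    rw [hcount] at this
    exact Nat.lt_of_add_lt_add_left this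
  · intro h t ht
    by_cases htA : t < #A
    · refine htA.trans_le (Finset.card_le_card fun j hj => ?_)
      have := (hA j).2 hj
      simp only [mem_filter, mem_univ, true_and]
      omega
    · obtain ⟨s, rfl⟩ := Nat.exists_eq_add_of_le (not_lt.1 htA)
      rw [hcount]
      exact Nat.add_lt_add_left (h s (by omega)) _

/-- A parking function whose values below `l` are taken exactly on `A` consists of an arbitrary
function on `A` and a parking function on the complement of `A`. -/
def splitEquiv [DecidableEq α] (A : Finset α) :
    {f : {f : α → ℕ // IsParking k l f} // ({j | f.1 j < l} : Finset α) = A} ≃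
      (A → Fin l) × {g : {j // j ∉ A} → ℕ // IsParking k (k * #A) g} where
  toFun f :=
    have hA (j) : f.1.1 j < l ↔ j ∈ A := by simpa using Finset.ext_iff.1 f.2 j
    (fun j => ⟨f.1.1 j, (hA j).2 j.2⟩,
      ⟨fun j => f.1.1 j - l, (iff_of_lt_iff_mem A hA).1 f.1.2⟩)
  invFun p :=
    have hA (j) : (if h : j ∈ A then (p.1 ⟨j, h⟩ : ℕ) else l + p.2.1 ⟨j, h⟩) < l ↔ j ∈ A := by
      split_ifs with h <;> simp [h]
    ⟨⟨fun j => if h : j ∈ A then p.1 ⟨j, h⟩ else l + p.2.1 ⟨j, h⟩, by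
      rw [iff_of_lt_iff_mem A hA]
      convert p.2.2 using 2 with j
      simp [j.2]⟩, by ext j; simp [hA]⟩
  left_inv f := by
    have hA (j) : f.1.1 j < l ↔ j ∈ A := by simpa using Finset.ext_iff.1 f.2 j
    ext j
    dsimp only
    split_ifs with h
    · rfl
    · have := mt (hA j).1 h
      omega
  right_inv p := by
    ext j
    · simp
    · simp [j.2]

theorem card_eq_sum [DecidableEq α] (k l : ℕ) :
    Nat.card {f : α → ℕ // IsParking k l f} =
      ∑ A : Finset α, l ^ #A * Nat.card {g : {j // j ∉ A} → ℕ // IsParking k (k * #A) g} := by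
  rw [← Nat.card_congr (Equiv.sigmaFiberEquiv
    fun f : {f : α → ℕ // IsParking k l f} => ({j | f.1 j < l} : Finset α)), Nat.card_sigma]
  refine Finset.sum_congr rfl fun A _ => ?_
  rw [Nat.card_congr (splitEquiv A), Nat.card_prod]
  simp

theorem sum_choose_mul (n k l : ℕ) :
    ∑ s ∈ range (n + 2), (n + 1).choose s *
      (l ^ s * if s = n + 1 then 1 else k * s * (k * (n + 1)) ^ (n - s)) =
      l * (l + k * (n + 1)) ^ n := by
  rw [Finset.sum_range_succ', add_pow, Finset.mul_sum]
  have h0 : (if 0 = n + 1 then 1 else k * 0 * (k * (n + 1)) ^ (n - 0)) = 0 := by simp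
  rw [h0, mul_zero, mul_zero, add_zero]
  refine Finset.sum_congr rfl fun s hs => ?_
  have hs' : s ≤ n := Nat.lt_succ_iff.1 (mem_range.1 hs)
  obtain rfl | hlt := hs'.eq_or_lt
  · simp [pow_succ']
  · have hne : s + 1 ≠ n + 1 := by omega
    have hsub : n - s = n - (s + 1) + 1 := by omega
    have hch := Nat.add_one_mul_choose_eq n s
    rw [if_neg hne, hsub, pow_succ (k * (n + 1))]
    linear_combination (l ^ (s + 1) * k * (k * (n + 1)) ^ (n - (s + 1))) * hch.symm

theorem card_eq (n k l : ℕ) (α : Type*) [Fintype α] (hα : Fintype.card α = n) :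
    Nat.card {f : α → ℕ // IsParking k l f} =
      if n = 0 then 1 else l * (l + k * n) ^ (n - 1) := by
  classical
  induction n using Nat.strong_induction_on generalizing α l with
  | _ n ih =>
  obtain _ | n := n
  · have := Fintype.card_eq_zero_iff.1 hα
    have hp (f : α → ℕ) : IsParking k l f := fun t ht => by omega
    simp [hp]
  have hsum := Finset.sum_powerset_apply_card
    (fun s => l ^ s * if s = n + 1 then 1 else k * s * (k * (n + 1)) ^ (n - s))
    (x := (univ : Finset α))
  simp only [smul_eq_mul, card_univ, hα, powerset_univ] at hsum
  rw [if_neg n.succ_ne_zero, Nat.add_sub_cancel, ← sum_choose_mul, ← hsum, card_eq_sum]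
  refine Finset.sum_congr rfl fun A _ => congrArg _ ?_
  have hle : #A ≤ n + 1 := hα ▸ Finset.card_le_univ A
  have hcompl : Fintype.card {j // j ∉ A} = n + 1 - #A := by
    simp [Fintype.card_subtype_compl, hα]
  obtain hA | hA := (#A).eq_zero_or_pos
  · have hempty : IsEmpty {g : {j // j ∉ A} → ℕ // IsParking k (k * #A) g} :=
      ⟨fun g => by simpa [hA] using g.2 0 (by omega)⟩
    rw [Nat.card_of_isEmpty]
    simp [hA]
  · rw [ih (n + 1 - #A) (by omega) _ _ hcompl]
    have hiff : n + 1 - #A = 0 ↔ #A = n + 1 := by omega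
    simp only [hiff]
    have hexp : n + 1 - #A - 1 = n - #A := by omega
    rw [hexp, ← mul_add, Nat.add_sub_cancel' hle]

end IsParking

theorem coe_comp_sort_lt_iff {n M : ℕ} (f : Fin n → Fin M) (i : Fin n) (c : ℕ) :
    ((f ∘ Tuple.sort f) i : ℕ) < c ↔ (i : ℕ) < #{j | (f j : ℕ) < c} := by
  rw [← Tuple.lt_card_lt_iff_apply_lt_of_monotone (f := fun j => ((f ∘ Tuple.sort f) j : ℕ))
    fun a b hab => Tuple.monotone_sort f hab]
  rw [← Finset.card_map (Tuple.sort f).toEmbedding]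
  suffices h : ({j | ((f ∘ Tuple.sort f) j : ℕ) < c} : Finset (Fin n)).map
      (Tuple.sort f).toEmbedding = ({j | (f j : ℕ) < c} : Finset (Fin n)) by rw [h]
  ext j
  simp [Finset.mem_map_equiv]

theorem stmt14 (n k l : ℕ) (hn : 1 ≤ n) (hk : 1 ≤ k) (hl : 1 ≤ l) :
    (klPFset n k l).card = l * (l + k * n) ^ (n - 1) := by
  have hcard := IsParking.card_eq n k l (Fin n) (Fintype.card_fin n)
  rw [if_neg (by omega)] at hcard
  rw [← hcard, ← Nat.card_eq_finsetCard]
  have hmem (f : Fin n → Fin (l + (n - 1) * k)) :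
      f ∈ klPFset n k l ↔ IsParking k l fun j => (f j : ℕ) := by
    simp only [klPFset, mem_filter, mem_univ, true_and, coe_comp_sort_lt_iff, IsParking,
      Fintype.card_fin]
    exact Fin.forall_iff
  refine Nat.card_congr
    { toFun := fun f => ⟨fun j => f.1 j, (hmem _).1 f.2⟩
      invFun := fun f => ⟨fun j => ⟨f.1 j, by simpa using f.2.apply_lt j⟩, (hmem _).2 f.2⟩
      left_inv := fun _ => rfl
      right_inv := fun _ => rfl }
end
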